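/- arXiv:1307.5923 — 2 statements merged into one kernel-verified Lean document; each statement's English description precedes it below -/
import Mathlib

section
/- Let q ≥ 0 be an integer, and suppose r_0,…,r_q ∈ [0,1] and ω_0,…,ω_q ∈ ℝ satisfy ∫_0^1 p(t) dt = Σ_{l=0}^{q} ω_l·p(r_l) for every univariate polynomial p of degree at most 2q+1 (e.g., the (q+1)-point Gauss–Legendre rule on [0,1]). Then for every polynomial g ∈ ℝ[x,y] of total degree at most 2q: ∫_{B₂} g(x,y) dx dy = Σ_{l=0}^{q} Σ_{m=0}^{2q} g(r_l·cos θ_m, r_l·sin θ_m)·ω_l·(2π/(2q+1))·r_l, where θ_m = 2πm/(2q+1). -/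
open MeasureTheory Real Filter

/-- The Gegenbauer polynomials `C_n^λ`, defined by their triple recursion. -/
noncomputable def gegenbauer (lam : ℝ) : ℕ → ℝ → ℝ
  | 0, _ => 1
  | 1, t => 2 * lam * t
  | (n + 2), t =>
      (2 * (((n : ℝ) + 1) + lam) / ((n : ℝ) + 2)) * t * gegenbauer lam (n + 1) t
        - ((((n : ℝ) + 1) + 2 * lam - 1) / ((n : ℝ) + 2)) * gegenbauer lam n t

/-- The open unit disk in `ℝ²`. -/
def unitDisk : Set (ℝ × ℝ) := {p | p.1 ^ 2 + p.2 ^ 2 < 1}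

/-- The normalization constant `h_{k,n}`. -/
noncomputable def hConst (k n : ℕ) : ℝ :=
  Real.sqrt ((π / 4 ^ k) * (Nat.factorial (n + k + 1)) /
    (((n : ℝ) + 1) * (2 * (k : ℝ) + 1) * ((Nat.factorial k : ℝ)) ^ 2 *
      (Nat.factorial (n - k) : ℝ)))

/-- The orthonormal polynomial basis `Q_n^k` on the unit disk. -/
noncomputable def Q2 (n k : ℕ) (x y : ℝ) : ℝ :=
  (1 / hConst k n) * gegenbauer ((k : ℝ) + 1) (n - k) x *
    (1 - x ^ 2) ^ ((k : ℝ) / 2) * gegenbauer (1 / 2) k (y / Real.sqrt (1 - x ^ 2))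

/-- The `(2q+1)`-point trapezoidal rule integrates `θ ↦ exp (i k θ)` exactly for `|k| ≤ 2q`. -/
theorem trapezoidal_exact_exp (q : ℕ) (k : ℤ) (hk : k.natAbs ≤ 2 * q) :
    (∫ θ in (-π)..π, Complex.exp (k * Complex.I * (θ : ℂ))) =
      (2 * π / (2 * q + 1)) * ∑ m ∈ Finset.range (2 * q + 1),
        Complex.exp (k * Complex.I * ((2 * π * m / (2 * q + 1) : ℝ) : ℂ)) := by
  have hN : (2 * (q : ℂ) + 1) ≠ 0 := by exact_mod_cast (2 * q).succ_ne_zero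
  rcases eq_or_ne k 0 with rfl | hk0
  · simp only [Int.cast_zero, zero_mul, Complex.exp_zero, intervalIntegral.integral_const,
      Finset.sum_const, Finset.card_range, nsmul_eq_mul, Complex.real_smul]
    push_cast
    field_simp
    ring
  · have hc : (k : ℂ) * Complex.I ≠ 0 :=
      mul_ne_zero (Int.cast_ne_zero.mpr hk0) Complex.I_ne_zero
    have hint : (∫ θ in (-π)..π, Complex.exp (k * Complex.I * (θ : ℂ))) = 0 := by
      rw [integral_exp_mul_complex hc, div_eq_zero_iff, sub_eq_zero]
      left
      rw [Complex.exp_eq_exp_iff_exists_int]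
      exact ⟨k, by push_cast; ring⟩
    have hζ := Complex.isPrimitiveRoot_exp (2 * q + 1) (2 * q).succ_ne_zero
    set ζ := Complex.exp (2 * π * Complex.I / ((2 * q + 1 : ℕ) : ℂ)) with hζdef
    have hterm (m : ℕ) : Complex.exp (k * Complex.I * ((2 * π * m / (2 * q + 1) : ℝ) : ℂ)) =
        (ζ ^ k) ^ m := by
      rw [hζdef, ← Complex.exp_int_mul, ← Complex.exp_nat_mul]
      congr 1
      push_cast
      field_simp
    have hne : ζ ^ k ≠ 1 := by
      rw [Ne, hζ.zpow_eq_one_iff_dvd]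
      intro h
      exact hk0 (Int.eq_zero_of_dvd_of_natAbs_lt_natAbs h (by omega))
    have hpow : (ζ ^ k) ^ (2 * q + 1) = 1 := by
      rw [← zpow_natCast, zpow_comm, zpow_natCast, hζ.pow_eq_one, one_zpow]
    simp only [hint, hterm, geom_sum_eq hne, hpow, sub_self, zero_div, mul_zero]

/-- The `(2q+1)`-point trapezoidal rule integrates `θ ↦ exp (i k θ) cos θ ^ a sin θ ^ b` exactly
for `|k| + a + b ≤ 2q`. -/
theorem trapezoidal_exact_exp_mul_cos_pow_mul_sin_pow (q : ℕ) (a b : ℕ) (k : ℤ)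
    (hk : k.natAbs + a + b ≤ 2 * q) :
    (∫ θ in (-π)..π, Complex.exp (k * Complex.I * (θ : ℂ)) *
        (Complex.cos θ ^ a * Complex.sin θ ^ b)) =
      (2 * π / (2 * q + 1)) * ∑ m ∈ Finset.range (2 * q + 1),
        Complex.exp (k * Complex.I * ((2 * π * m / (2 * q + 1) : ℝ) : ℂ)) *
          (Complex.cos (2 * π * m / (2 * q + 1) : ℝ) ^ a *
            Complex.sin (2 * π * m / (2 * q + 1) : ℝ) ^ b) := by
  have hadd (k : ℤ) (z : ℂ) : Complex.exp (((k + 1 : ℤ) : ℂ) * Complex.I * z) =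
      Complex.exp (k * Complex.I * z) * Complex.exp (z * Complex.I) := by
    rw [← Complex.exp_add]; congr 1; push_cast; ring
  have hsub (k : ℤ) (z : ℂ) : Complex.exp (((k - 1 : ℤ) : ℂ) * Complex.I * z) =
      Complex.exp (k * Complex.I * z) * Complex.exp (-z * Complex.I) := by
    rw [← Complex.exp_add]; congr 1; push_cast; ring
  induction a generalizing k with
  | zero =>
    induction b generalizing k with
    | zero => simpa using trapezoidal_exact_exp q k (by omega)
    | succ b ih =>
      have key (z : ℂ) : Complex.exp (k * Complex.I * z) *
          (Complex.cos z ^ 0 * Complex.sin z ^ (b + 1)) =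
          (Complex.I / 2) * (Complex.exp (((k - 1 : ℤ) : ℂ) * Complex.I * z) *
            (Complex.cos z ^ 0 * Complex.sin z ^ b)) -
          (Complex.I / 2) * (Complex.exp (((k + 1 : ℤ) : ℂ) * Complex.I * z) *
            (Complex.cos z ^ 0 * Complex.sin z ^ b)) := by
        rw [hadd, hsub, pow_succ, show Complex.sin z = (Complex.exp (-z * Complex.I) -
          Complex.exp (z * Complex.I)) * Complex.I / 2 from rfl]
        ring
      simp only [key]
      rw [intervalIntegral.integral_sub
        (Continuous.intervalIntegrable (by fun_prop) _ _)
        (Continuous.intervalIntegrable (by fun_prop) _ _),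
        intervalIntegral.integral_const_mul, intervalIntegral.integral_const_mul,
        ih (k - 1) (by omega), ih (k + 1) (by omega), Finset.sum_sub_distrib,
        ← Finset.mul_sum, ← Finset.mul_sum]
      ring
  | succ a ih =>
    have key (z : ℂ) : Complex.exp (k * Complex.I * z) *
        (Complex.cos z ^ (a + 1) * Complex.sin z ^ b) =
        (1 / 2) * (Complex.exp (((k + 1 : ℤ) : ℂ) * Complex.I * z) *
          (Complex.cos z ^ a * Complex.sin z ^ b)) +
        (1 / 2) * (Complex.exp (((k - 1 : ℤ) : ℂ) * Complex.I * z) *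
          (Complex.cos z ^ a * Complex.sin z ^ b)) := by
      rw [hadd, hsub, pow_succ, show Complex.cos z = (Complex.exp (z * Complex.I) +
        Complex.exp (-z * Complex.I)) / 2 from rfl]
      ring
    simp only [key]
    rw [intervalIntegral.integral_add
      (Continuous.intervalIntegrable (by fun_prop) _ _)
      (Continuous.intervalIntegrable (by fun_prop) _ _),
      intervalIntegral.integral_const_mul, intervalIntegral.integral_const_mul,
      ih (k - 1) (by omega), ih (k + 1) (by omega), Finset.sum_add_distrib,
      ← Finset.mul_sum, ← Finset.mul_sum]
    ring

/-- The `(2q+1)`-point trapezoidal rule integrates `cos θ ^ a sin θ ^ b` exactly for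
`a + b ≤ 2q`. -/
theorem trapezoidal_exact_cos_pow_mul_sin_pow (q a b : ℕ) (hab : a + b ≤ 2 * q) :
    (∫ θ in (-π)..π, cos θ ^ a * sin θ ^ b) =
      (2 * π / (2 * q + 1)) * ∑ m ∈ Finset.range (2 * q + 1),
        cos (2 * π * m / (2 * q + 1)) ^ a * sin (2 * π * m / (2 * q + 1)) ^ b := by
  have h := trapezoidal_exact_exp_mul_cos_pow_mul_sin_pow q a b 0 (by simpa using hab)
  simp only [Int.cast_zero, zero_mul, Complex.exp_zero, one_mul, ← Complex.ofReal_cos,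
    ← Complex.ofReal_sin, ← Complex.ofReal_pow, ← Complex.ofReal_mul,
    intervalIntegral.integral_ofReal] at h
  exact_mod_cast h

theorem measurableSet_unitDisk : MeasurableSet unitDisk :=
  measurableSet_lt (by fun_prop) measurable_const

theorem unitDisk_subset_Icc : unitDisk ⊆ Set.Icc (-1 : ℝ) 1 ×ˢ Set.Icc (-1 : ℝ) 1 := by
  intro p hp
  have hp : p.1 ^ 2 + p.2 ^ 2 < 1 := hp
  exact ⟨abs_le.mp (abs_le_one_iff_mul_self_le_one.mpr (by nlinarith [sq_nonneg p.2])),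
    abs_le.mp (abs_le_one_iff_mul_self_le_one.mpr (by nlinarith [sq_nonneg p.1]))⟩

/-- Integration over the unit disk in polar coordinates. -/
theorem setIntegral_unitDisk_eq_polar (f : ℝ × ℝ → ℝ) :
    (∫ p in unitDisk, f p) =
      ∫ p in Set.Ioo (0 : ℝ) 1 ×ˢ Set.Ioo (-π) π,
        p.1 * f (p.1 * cos p.2, p.1 * sin p.2) := by
  have hmem (p : ℝ × ℝ) (hp : 0 < p.1) :
      (p.1 * cos p.2, p.1 * sin p.2) ∈ unitDisk ↔ p.1 < 1 := by
    change (p.1 * cos p.2) ^ 2 + (p.1 * sin p.2) ^ 2 < 1 ↔ _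
    rw [mul_pow, mul_pow, ← mul_add, cos_sq_add_sin_sq, mul_one, sq_lt_one_iff₀ hp.le]
  have hsub : Set.Ioo (0 : ℝ) 1 ×ˢ Set.Ioo (-π) π ⊆ polarCoord.target :=
    Set.prod_mono Set.Ioo_subset_Ioi_self subset_rfl
  rw [← integral_indicator measurableSet_unitDisk, ← integral_comp_polarCoord_symm]
  symm
  rw [setIntegral_eq_of_subset_of_forall_sdiff_eq_zero polarCoord.open_target.measurableSet hsub]
  · refine setIntegral_congr_fun (measurableSet_Ioo.prod measurableSet_Ioo) fun p hp => ?_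
    simp only [polarCoord_symm_apply, smul_eq_mul]
    rw [Set.indicator_of_mem ((hmem p hp.1.1).mpr hp.1.2)]
  · rintro p ⟨hp, hp'⟩
    have hp1 : 0 < p.1 := hp.1
    rw [polarCoord_symm_apply, Set.indicator_of_notMem, smul_zero]
    exact fun h => hp' ⟨⟨hp1, (hmem p hp1).mp h⟩, hp.2⟩

/-- Monomial integrals over the unit disk factor into radial and angular integrals. -/
theorem setIntegral_unitDisk_monomial (a b : ℕ) :
    (∫ p in unitDisk, p.1 ^ a * p.2 ^ b) =
      (∫ t in (0 : ℝ)..1, t ^ (a + b + 1)) * ∫ θ in (-π)..π, cos θ ^ a * sin θ ^ b := by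
  rw [setIntegral_unitDisk_eq_polar, intervalIntegral.integral_of_le zero_le_one,
    intervalIntegral.integral_of_le (by linarith [pi_pos]), integral_Ioc_eq_integral_Ioo,
    integral_Ioc_eq_integral_Ioo, ← setIntegral_prod_mul]
  refine setIntegral_congr_fun (measurableSet_Ioo.prod measurableSet_Ioo) fun p _ => ?_
  ring

/-- the quadrature rule combining a radial rule exact on degree
`≤ 2q+1` with the `(2q+1)`-point trapezoidal rule in the azimuthal variable is
exact for all bivariate polynomials of total degree at most `2q`. -/
theorem disk_quadrature_exact (q : ℕ) (r ω : ℕ → ℝ)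
    (hr : ∀ l ≤ q, r l ∈ Set.Icc (0 : ℝ) 1)
    (hquad : ∀ p : Polynomial ℝ, p.natDegree ≤ 2 * q + 1 →
      (∫ t in (0 : ℝ)..1, p.eval t) =
        ∑ l ∈ Finset.range (q + 1), ω l * p.eval (r l))
    (g : MvPolynomial (Fin 2) ℝ) (hg : g.totalDegree ≤ 2 * q) :
    (∫ p in unitDisk, MvPolynomial.eval ![p.1, p.2] g) =
      ∑ l ∈ Finset.range (q + 1), ∑ m ∈ Finset.range (2 * q + 1),
        MvPolynomial.eval
            ![r l * Real.cos (2 * π * m / (2 * q + 1)),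
              r l * Real.sin (2 * π * m / (2 * q + 1))] g *
          ω l * (2 * π / (2 * q + 1)) * r l := by
  have hint (d : Fin 2 →₀ ℕ) :
      IntegrableOn (fun p : ℝ × ℝ => g.coeff d * (p.1 ^ d 0 * p.2 ^ d 1)) unitDisk :=
    (Continuous.continuousOn (by fun_prop)).integrableOn_compact
      (isCompact_Icc.prod isCompact_Icc) |>.mono_set unitDisk_subset_Icc
  simp only [MvPolynomial.eval_eq', Fin.prod_univ_two, Matrix.cons_val_zero, Matrix.cons_val_one]
  rw [integral_finsetSum _ fun d _ => hint d]
  simp only [Finset.sum_mul]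
  simp_rw [Finset.sum_comm (t := g.support)]
  refine Finset.sum_congr rfl fun d hd => ?_
  have hdeg : d 0 + d 1 ≤ 2 * q := by
    have := (MvPolynomial.le_totalDegree hd).trans hg
    rwa [Finsupp.sum_fintype _ _ fun _ => rfl, Fin.sum_univ_two] at this
  have hrad := hquad (Polynomial.X ^ (d 0 + d 1 + 1)) (by rw [Polynomial.natDegree_X_pow]; omega)
  simp only [Polynomial.eval_pow, Polynomial.eval_X] at hrad
  rw [integral_const_mul, setIntegral_unitDisk_monomial, hrad,
    trapezoidal_exact_cos_pow_mul_sin_pow q _ _ hdeg, Finset.sum_mul, Finset.mul_sum]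
  refine Finset.sum_congr rfl fun l _ => ?_
  rw [Finset.mul_sum, Finset.mul_sum, Finset.mul_sum]
  refine Finset.sum_congr rfl fun m _ => ?_
  ring
end

section
/- Let n ≥ 0 and q ≥ n be integers, and suppose r_0,…,r_q ∈ [0,1] and ω_0,…,ω_q ∈ ℝ satisfy ∫_0^1 p(t) dt = Σ_{l=0}^{q} ω_l·p(r_l) for every univariate polynomial p of degree at most 2q+1. For continuous functions f, g on the closed unit disk define ⟨f,g⟩_q = Σ_{l=0}^{q} Σ_{m=0}^{2q} f(r_l cos θ_m, r_l sin θ_m)·g(r_l cos θ_m, r_l sin θ_m)·ω_l·(2π/(2q+1))·r_l with θ_m = 2πm/(2q+1). Then for every polynomial f ∈ ℝ[x,y] of total degree at most n and every (x,y) ∈ B₂: f(x,y) = Σ_{j=0}^{n} Σ_{k=0}^{j} ⟨f, Q_j^k⟩_q·Q_j^k(x,y); that is, the discrete least squares (hyperinterpolation) operator reproduces all polynomials of degree at most n. -/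
open MeasureTheory Real Filter

lemma gegenbauer_succ_succ (lam : ℝ) (n : ℕ) (t : ℝ) :
    ((n : ℝ) + 2) * gegenbauer lam (n + 2) t =
      2 * (n + 1 + lam) * t * gegenbauer lam (n + 1) t - (n + 2 * lam) * gegenbauer lam n t := by
  have h : (n : ℝ) + 2 ≠ 0 := by positivity
  rw [gegenbauer]
  field_simp
  ring

@[fun_prop]
lemma continuous_gegenbauer (lam : ℝ) (n : ℕ) : Continuous (gegenbauer lam n) := by
  induction n using Nat.twoStepInduction with
  | zero => simpa only [funext fun t => gegenbauer.eq_1 lam t] using continuous_const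
  | one =>
    rw [funext fun t => gegenbauer.eq_2 lam t]
    fun_prop
  | more n h₀ h₁ =>
    rw [funext fun t => gegenbauer.eq_3 lam t n]
    fun_prop

/-- The first-order lowering relation
`(1 - t²) (C_n^λ)'(t) = (n + 2λ) t C_n^λ(t) - (n + 1) C_{n+1}^λ(t)`. -/
lemma exists_hasDerivAt_gegenbauer (lam : ℝ) (n : ℕ) (t : ℝ) :
    ∃ d, HasDerivAt (gegenbauer lam n) d t ∧
      (1 - t ^ 2) * d =
        (n + 2 * lam) * t * gegenbauer lam n t - (n + 1) * gegenbauer lam (n + 1) t := by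
  induction n using Nat.twoStepInduction with
  | zero =>
    refine ⟨0, ?_, ?_⟩
    · rw [funext fun t => gegenbauer.eq_1 lam t]
      exact hasDerivAt_const _ _
    · simp [gegenbauer]
  | one =>
    refine ⟨2 * lam, ?_, ?_⟩
    · rw [funext fun t => gegenbauer.eq_2 lam t]
      simpa using (hasDerivAt_id t).const_mul (2 * lam)
    · have := gegenbauer_succ_succ lam 0 t
      simp only [gegenbauer.eq_1, gegenbauer.eq_2, Nat.cast_zero, Nat.cast_one, zero_add] at this ⊢
      linear_combination this
  | more n h₀ h₁ =>
    obtain ⟨d₀, hd₀, e₀⟩ := h₀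
    obtain ⟨d₁, hd₁, e₁⟩ := h₁
    have hn : (n : ℝ) + 2 ≠ 0 := by positivity
    have hd : HasDerivAt (gegenbauer lam (n + 2))
        (2 * (n + 1 + lam) / (n + 2) * (gegenbauer lam (n + 1) t + t * d₁) -
          (n + 1 + 2 * lam - 1) / (n + 2) * d₀) t := by
      rw [funext fun t => gegenbauer.eq_3 lam t n]
      refine ((((hasDerivAt_id t).const_mul (2 * ((n : ℝ) + 1 + lam) / (n + 2))).mul hd₁).sub
        (hd₀.const_mul (((n : ℝ) + 1 + 2 * lam - 1) / (n + 2)))).congr_deriv ?_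
      simp only [id]
      ring
    refine ⟨_, hd, ?_⟩
    · have r₀ := gegenbauer_succ_succ lam n t
      have r₁ := gegenbauer_succ_succ lam (n + 1) t
      push_cast at r₁ e₁ ⊢
      apply mul_left_cancel₀ hn
      simp only [Nat.add_assoc, Nat.reduceAdd] at r₁ e₁ ⊢
      field_simp
      linear_combination 2 * (n + 1 + lam) * t * e₁ - (n + 2 * lam) * e₀
        + (n + 2 : ℝ) * r₁ - (n + 2 * lam) * t * r₀

/-- Orthogonality of a family with Gegenbauer-type recurrence: `e m n` stands for the inner product
of the `m`-th and the `n`-th member, `X m n` for that of the `m`-th one and `t` times the `n`-th. -/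
lemma gegenbauer_gram_of_lt {lam : ℝ} (hlam : 0 < lam) {e X : ℕ → ℕ → ℝ}
    (hX : ∀ m n, X m n = X n m)
    (hrec : ∀ m n, 2 * (n + 1 + lam) * X m (n + 1) = (n + 2) * e m (n + 2) + (n + 2 * lam) * e m n)
    (he : ∀ m n, e m n = e n m) (hrec₀ : ∀ m, e m 1 = 2 * lam * X m 0)
    (hzero : ∀ n, e 0 (n + 1) = 0) (m : ℕ) : ∀ n, m < n → e m n = 0 := by
  have key : ∀ m n, e m (n + 2) = 0 → e m n = 0 → X m (n + 1) = 0 := by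
    intro m n h₂ h₀
    have h := hrec m n
    rw [h₂, h₀, mul_zero, mul_zero, add_zero] at h
    exact (mul_eq_zero.1 h).resolve_left (by positivity)
  induction m using Nat.twoStepInduction with
  | zero =>
    rintro (_ | n) h
    · omega
    · exact hzero n
  | one =>
    rintro (_ | _ | n) h
    · omega
    · omega
    · rw [he, hrec₀, hX, key 0 (n + 1) (hzero _) (hzero _), mul_zero]
  | more m h₀ h₁ =>
    rintro (_ | n) h
    · omega
    · have h' := hrec (n + 1) m
      rw [hX, key (m + 1) n (h₁ _ (by omega)) (h₁ _ (by omega)), he _ m, h₀ _ (by omega), mul_zero,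
        mul_zero, add_zero, eq_comm] at h'
      rw [he]
      exact (mul_eq_zero.1 h').resolve_left (by positivity)

lemma gegenbauer_gram_diag {lam : ℝ} (hlam : 0 < lam) {e X : ℕ → ℕ → ℝ}
    (hX : ∀ m n, X m n = X n m)
    (hrec : ∀ m n, 2 * (n + 1 + lam) * X m (n + 1) = (n + 2) * e m (n + 2) + (n + 2 * lam) * e m n)
    (he : ∀ m n, e m n = e n m) (hrec₀ : ∀ m, e m 1 = 2 * lam * X m 0)
    (hzero : ∀ n, e 0 (n + 1) = 0) (n : ℕ) :
    (n + 1) * (n + 1 + lam) * e (n + 1) (n + 1) = (n + 2 * lam) * (n + lam) * e n n := by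
  have horth := gegenbauer_gram_of_lt hlam hX hrec he hrec₀ hzero
  have h := hrec n n
  rw [horth n (n + 2) (by omega), mul_zero, zero_add] at h
  rcases n with _ | n
  · have h₁ := hrec₀ 1
    rw [hX] at h₁
    simp only [zero_add, Nat.cast_zero] at h ⊢
    linear_combination (1 + lam) * h₁ + lam * h
  · have h₁ := hrec (n + 2) n
    rw [he _ n, horth n (n + 2) (by omega), mul_zero, add_zero] at h₁
    rw [hX] at h
    push_cast at h ⊢
    linear_combination (n + 1 + lam) * h - (n + 2 + lam) * h₁

/-- The integral `∫ p(t) (1 - t²)^((ν-1)/2) dt` over `[-1, 1]` in the variable `t = cos φ`. -/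
noncomputable def sinWeightIntegral (ν : ℕ) (p : ℝ → ℝ) : ℝ :=
  ∫ φ in (0 : ℝ)..π, p (cos φ) * sin φ ^ ν

lemma sinWeightIntegral_lin (ν : ℕ) {p s : ℝ → ℝ} (hp : Continuous p) (hs : Continuous s)
    (a b : ℝ) :
    sinWeightIntegral ν (fun t => a * p t + b * s t) =
      a * sinWeightIntegral ν p + b * sinWeightIntegral ν s := by
  unfold sinWeightIntegral
  rw [← intervalIntegral.integral_const_mul, ← intervalIntegral.integral_const_mul,
    ← intervalIntegral.integral_add]
  · congr 1; ext φ; ring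
  all_goals exact Continuous.intervalIntegrable (by fun_prop) _ _

lemma sinWeightIntegral_mul_gegenbauer_succ (ν n : ℕ) (lam : ℝ) {p : ℝ → ℝ} (hp : Continuous p) :
    2 * (n + 1 + lam) * sinWeightIntegral ν (fun t => p t * (t * gegenbauer lam (n + 1) t)) =
      (n + 2) * sinWeightIntegral ν (fun t => p t * gegenbauer lam (n + 2) t) +
        (n + 2 * lam) * sinWeightIntegral ν (fun t => p t * gegenbauer lam n t) := by
  rw [← sinWeightIntegral_lin ν (by fun_prop) (by fun_prop)]
  unfold sinWeightIntegral
  rw [← intervalIntegral.integral_const_mul]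
  congr 1; ext φ
  linear_combination - p (cos φ) * sin φ ^ ν * gegenbauer_succ_succ lam n (cos φ)

/-- Integrating the derivative of `C_n^λ(cos φ) sin^{2λ+1} φ`. -/
lemma sinWeightIntegral_gegenbauer_parts (ν n : ℕ) :
    ((n : ℝ) - 1) * sinWeightIntegral ν (fun t => t * gegenbauer (ν / 2) n t) =
      (n + 1) * sinWeightIntegral ν (gegenbauer (ν / 2) (n + 1)) := by
  have h : ∫ φ in (0 : ℝ)..π, ((n + 1) * gegenbauer (ν / 2) (n + 1) (cos φ) +
      (1 - (n : ℝ)) * (cos φ * gegenbauer (ν / 2) n (cos φ))) * sin φ ^ ν =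
      gegenbauer (ν / 2) n (cos π) * sin π ^ (ν + 1) -
        gegenbauer (ν / 2) n (cos 0) * sin 0 ^ (ν + 1) := by
    refine intervalIntegral.integral_eq_sub_of_hasDerivAt
      (f := fun φ => gegenbauer (ν / 2) n (cos φ) * sin φ ^ (ν + 1)) (fun φ _ => ?_)
      (Continuous.intervalIntegrable (by fun_prop) _ _)
    obtain ⟨d, hd, e⟩ := exists_hasDerivAt_gegenbauer (ν / 2) n (cos φ)
    refine ((hd.comp φ (hasDerivAt_cos φ)).mul ((hasDerivAt_sin φ).pow (ν + 1))).congr_deriv ?_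
    simp only [Function.comp, Nat.add_sub_cancel, Pi.pow_apply]
    have hs := sin_sq_add_cos_sq φ
    push_cast
    linear_combination (-sin φ ^ ν) * e - d * sin φ ^ ν * hs
  have hl := sinWeightIntegral_lin ν (p := gegenbauer (ν / 2) (n + 1))
    (s := fun t => t * gegenbauer (ν / 2) n t) (by fun_prop) (by fun_prop) (n + 1) (1 - n)
  rw [show sinWeightIntegral ν (fun t => (n + 1) * gegenbauer (ν / 2) (n + 1) t +
      (1 - (n : ℝ)) * (t * gegenbauer (ν / 2) n t)) = 0 by
    unfold sinWeightIntegral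
    rw [h]
    simp] at hl
  linear_combination hl

lemma sinWeightIntegral_gegenbauer_succ (ν n : ℕ) :
    sinWeightIntegral ν (gegenbauer (ν / 2) (n + 1)) = 0 := by
  induction n using Nat.twoStepInduction with
  | zero =>
    have h := sinWeightIntegral_gegenbauer_parts ν 0
    have h₁ := sinWeightIntegral_lin ν (p := fun t => t * gegenbauer (ν / 2) 0 t) (s := fun _ => 0)
      (by fun_prop) (by fun_prop) ν 0
    rw [show (fun t => (ν : ℝ) * (t * gegenbauer (ν / 2) 0 t) + 0 * 0) = gegenbauer (ν / 2) 1 by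
      ext t; simp only [gegenbauer]; ring] at h₁
    simp only [Nat.cast_zero, zero_add] at h ⊢
    have h₂ : (ν + 1 : ℝ) * sinWeightIntegral ν (gegenbauer (ν / 2) 1) = 0 := by
      linear_combination h₁ - ν * h
    exact (mul_eq_zero.1 h₂).resolve_left (by positivity)
  | one =>
    have h := sinWeightIntegral_gegenbauer_parts ν 1
    norm_num at h
    exact h
  | more n h₀ _ =>
    have h := sinWeightIntegral_gegenbauer_parts ν (n + 2)
    have h' := sinWeightIntegral_mul_gegenbauer_succ ν (n + 1) (ν / 2) (p := fun _ => 1)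
      continuous_const
    simp only [one_mul, Nat.add_assoc, Nat.reduceAdd] at h h' h₀ ⊢
    rw [show (fun t => gegenbauer ((ν : ℝ) / 2) (n + 1) t) = gegenbauer (ν / 2) (n + 1) from rfl,
      h₀] at h'
    push_cast at h h'
    have h₂ : ((n : ℝ) + 3) * (n + 3 + ν) *
        sinWeightIntegral ν (gegenbauer (ν / 2) (n + 3)) = 0 := by
      linear_combination (n + 1 : ℝ) * h' - (2 * (n + 2 + ν / 2) : ℝ) * h
    exact (mul_eq_zero.1 h₂).resolve_left (by positivity)

lemma gegenbauer_gram_hypotheses (ν : ℕ) :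
    let e : ℕ → ℕ → ℝ := fun m n =>
      sinWeightIntegral ν (fun t => gegenbauer (ν / 2) m t * gegenbauer (ν / 2) n t)
    let X : ℕ → ℕ → ℝ := fun m n =>
      sinWeightIntegral ν (fun t => gegenbauer (ν / 2) m t * (t * gegenbauer (ν / 2) n t))
    (∀ m n, X m n = X n m) ∧
      (∀ m n, 2 * (n + 1 + (ν / 2 : ℝ)) * X m (n + 1) =
        (n + 2) * e m (n + 2) + (n + 2 * (ν / 2 : ℝ)) * e m n) ∧
      (∀ m n, e m n = e n m) ∧ (∀ m, e m 1 = 2 * (ν / 2 : ℝ) * X m 0) ∧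
      ∀ n, e 0 (n + 1) = 0 := by
  refine ⟨fun m n => ?_, fun m n => ?_, fun m n => ?_, fun m => ?_, fun n => ?_⟩
  · dsimp only
    congr 1; ext t; ring
  · exact sinWeightIntegral_mul_gegenbauer_succ ν n _ (continuous_gegenbauer _ m)
  · dsimp only
    congr 1; ext t; ring
  · have h := sinWeightIntegral_lin ν (p := fun t => gegenbauer (ν / 2) m t *
      (t * gegenbauer (ν / 2) 0 t)) (s := fun _ => 0) (by fun_prop) (by fun_prop) (2 * (ν / 2)) 0
    simp only [zero_mul, mul_zero, add_zero] at h
    dsimp only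
    rw [← h]
    congr 1; ext t; simp only [gegenbauer]; ring
  · simpa only [gegenbauer.eq_1, one_mul] using sinWeightIntegral_gegenbauer_succ ν n

lemma sinWeightIntegral_gegenbauer_mul_of_ne {ν : ℕ} (hν : 0 < ν) {m n : ℕ} (hmn : m ≠ n) :
    sinWeightIntegral ν (fun t => gegenbauer (ν / 2) m t * gegenbauer (ν / 2) n t) = 0 := by
  obtain ⟨h₁, h₂, h₃, h₄, h₅⟩ := gegenbauer_gram_hypotheses ν
  have h := gegenbauer_gram_of_lt (by positivity) h₁ h₂ h₃ h₄ h₅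
  rcases hmn.lt_or_gt with h' | h'
  · exact h m n h'
  · simpa only [mul_comm] using h n m h'

lemma sinWeightIntegral_gegenbauer_sq_succ {ν : ℕ} (hν : 0 < ν) (n : ℕ) :
    (n + 1) * (n + 1 + (ν / 2 : ℝ)) * sinWeightIntegral ν
        (fun t => gegenbauer (ν / 2) (n + 1) t * gegenbauer (ν / 2) (n + 1) t) =
      (n + 2 * (ν / 2 : ℝ)) * (n + (ν / 2 : ℝ)) *
        sinWeightIntegral ν (fun t => gegenbauer (ν / 2) n t * gegenbauer (ν / 2) n t) := by
  obtain ⟨h₁, h₂, h₃, h₄, h₅⟩ := gegenbauer_gram_hypotheses ν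
  exact gegenbauer_gram_diag (by positivity) h₁ h₂ h₃ h₄ h₅ n

lemma integral_sin_legendre_sq (n : ℕ) :
    sinWeightIntegral 1 (fun t => gegenbauer (1 / 2) n t * gegenbauer (1 / 2) n t) =
      2 / (2 * n + 1) := by
  induction n with
  | zero => simp [sinWeightIntegral, gegenbauer]; norm_num
  | succ n ih =>
    have h := sinWeightIntegral_gegenbauer_sq_succ one_pos n
    simp only [Nat.cast_one] at h
    rw [ih] at h
    push_cast
    rw [eq_div_iff (by positivity)]
    generalize sinWeightIntegral 1 _ = I at h ⊢
    field_simp at h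
    linear_combination h

/-- `∫ cos^a sin^(b+2)` over `[0, π]` in terms of `∫ cos^a sin^b`. -/
lemma sinWeightIntegral_pow_add_two (a b : ℕ) :
    ((a : ℝ) + b + 2) * sinWeightIntegral (b + 2) (fun t => t ^ a) =
      (b + 1) * sinWeightIntegral b (fun t => t ^ a) := by
  unfold sinWeightIntegral
  have h : ∫ φ in (0 : ℝ)..π, ((b + 1) * (cos φ ^ a * sin φ ^ b) -
      ((a : ℝ) + b + 2) * (cos φ ^ a * sin φ ^ (b + 2))) =
      cos π ^ (a + 1) * sin π ^ (b + 1) - cos 0 ^ (a + 1) * sin 0 ^ (b + 1) := by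
    refine intervalIntegral.integral_eq_sub_of_hasDerivAt
      (f := fun φ => cos φ ^ (a + 1) * sin φ ^ (b + 1)) (fun φ _ => ?_)
      (Continuous.intervalIntegrable (by fun_prop) _ _)
    refine (((hasDerivAt_cos φ).pow (a + 1)).mul
      ((hasDerivAt_sin φ).pow (b + 1))).congr_deriv ?_
    simp only [Nat.add_sub_cancel, Pi.pow_apply]
    have hs := sin_sq_add_cos_sq φ
    push_cast
    linear_combination (((b : ℝ) + 1) * cos φ ^ a * sin φ ^ b) * hs
  rw [intervalIntegral.integral_sub, intervalIntegral.integral_const_mul,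
    intervalIntegral.integral_const_mul] at h
  · simp at h
    linear_combination -h
  all_goals exact Continuous.intervalIntegrable (by fun_prop) _ _

lemma integral_sin_pow_two_mul_add_two (k : ℕ) :
    (4 ^ k * (Nat.factorial k : ℝ) ^ 2 * (2 * (k + 1))) *
        sinWeightIntegral (2 * k + 2) (fun _ => 1) =
      π * Nat.factorial (2 * k + 1) := by
  induction k with
  | zero =>
    have h := sinWeightIntegral_pow_add_two 0 0
    simp only [sinWeightIntegral, pow_zero] at h ⊢
    norm_num at h ⊢
    exact h
  | succ k ih =>
    have h := sinWeightIntegral_pow_add_two 0 (2 * k + 2)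
    simp only [pow_zero] at h
    rw [show 2 * (k + 1) + 2 = 2 * k + 2 + 2 by ring,
      show 2 * (k + 1) + 1 = 2 * k + 1 + 1 + 1 by ring,
      Nat.factorial_succ (2 * k + 1 + 1), Nat.factorial_succ (2 * k + 1), Nat.factorial_succ k,
      pow_succ]
    push_cast at h ⊢
    linear_combination (4 ^ k * 4 * ((k + 1) * (Nat.factorial k : ℝ)) ^ 2) * h +
      ((2 * k + 3) * 2 * (k + 1) : ℝ) * ih

lemma integral_gegenbauer_sq (k m : ℕ) :
    (Nat.factorial m * (m + k + 1) * Nat.factorial (2 * k + 1) : ℝ) * sinWeightIntegral (2 * k + 2)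
        (fun t => gegenbauer (k + 1) m t * gegenbauer (k + 1) m t) =
      Nat.factorial (m + 2 * k + 1) * (k + 1) * sinWeightIntegral (2 * k + 2) (fun _ => 1) := by
  induction m with
  | zero =>
    simp only [gegenbauer, mul_one, Nat.factorial_zero, zero_add, Nat.cast_zero, Nat.cast_one,
      one_mul]
    ring
  | succ m ih =>
    have h := sinWeightIntegral_gegenbauer_sq_succ (ν := 2 * k + 2) (by omega) m
    rw [show ((2 * k + 2 : ℕ) : ℝ) / 2 = k + 1 by push_cast; ring] at h
    rw [show m + 1 + 2 * k + 1 = m + 2 * k + 1 + 1 by ring, Nat.factorial_succ (m + 2 * k + 1),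
      Nat.factorial_succ m]
    push_cast at h ⊢
    linear_combination (Nat.factorial m * Nat.factorial (2 * k + 1) : ℝ) * h +
      (m + 2 * k + 2 : ℝ) * ih

/-- The product of the Gegenbauer and the Legendre norm is the normalization constant. -/
lemma gegenbauer_sq_mul_legendre_sq (k m : ℕ) :
    sinWeightIntegral (2 * k + 2) (fun t => gegenbauer (k + 1) m t * gegenbauer (k + 1) m t) *
      sinWeightIntegral 1 (fun t => gegenbauer (1 / 2) k t * gegenbauer (1 / 2) k t) =
      hConst k (m + k) ^ 2 := by
  have h₁ := integral_gegenbauer_sq k m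
  have h₂ := integral_sin_pow_two_mul_add_two k
  have hm : (Nat.factorial m : ℝ) ≠ 0 := by positivity
  have hk : (Nat.factorial k : ℝ) ≠ 0 := by positivity
  have hk' : (Nat.factorial (2 * k + 1) : ℝ) ≠ 0 := by positivity
  have hs : (m : ℝ) + k + 1 ≠ 0 := by positivity
  have hs' : (k : ℝ) + 1 ≠ 0 := by positivity
  rw [integral_sin_legendre_sq, hConst, sq_sqrt (by positivity), Nat.add_sub_cancel,
    show m + k + k + 1 = m + 2 * k + 1 by ring]
  have e₁ := eq_div_of_mul_eq (by positivity) ((mul_comm _ _).trans h₁)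
  have e₂ := eq_div_of_mul_eq (by positivity) ((mul_comm _ _).trans h₂)
  rw [e₁, e₂]
  push_cast
  field_simp

/-- The homogeneous form `(1 - x²)^(k/2) P_k(y / √(1 - x²))` of the Legendre polynomial. -/
noncomputable def solidLegendre : ℕ → ℝ × ℝ → ℝ
  | 0, _ => 1
  | 1, p => p.2
  | (k + 2), p =>
      ((2 * k + 3) / (k + 2)) * p.2 * solidLegendre (k + 1) p -
        ((k + 1) / (k + 2)) * (1 - p.1 ^ 2) * solidLegendre k p

lemma solidLegendre_eq {x s : ℝ} (hs : s ^ 2 = 1 - x ^ 2) (t : ℝ) (k : ℕ) :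
    solidLegendre k (x, s * t) = s ^ k * gegenbauer (1 / 2) k t := by
  induction k using Nat.twoStepInduction with
  | zero => simp [solidLegendre, gegenbauer]
  | one => simp [solidLegendre, gegenbauer]
  | more k h₀ h₁ =>
    have hk : (k : ℝ) + 2 ≠ 0 := by positivity
    simp only [solidLegendre, gegenbauer, h₀, h₁, ← hs]
    field_simp
    ring

/-- The unnormalized basis polynomials of the disk. -/
noncomputable def diskBasis (m k : ℕ) (p : ℝ × ℝ) : ℝ :=
  gegenbauer (k + 1) m p.1 * solidLegendre k p

lemma Q2_eq {x y : ℝ} (h : x ^ 2 + y ^ 2 ≤ 1) (n k : ℕ) :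
    Q2 n k x y = 1 / hConst k n * diskBasis (n - k) k (x, y) := by
  have hx : 0 ≤ 1 - x ^ 2 := by nlinarith [sq_nonneg y]
  have hy : √(1 - x ^ 2) * (y / √(1 - x ^ 2)) = y := by
    rcases hx.eq_or_lt with h0 | h0
    · have : y = 0 := by
        have : y ^ 2 ≤ 0 := by linarith
        exact pow_eq_zero_iff two_ne_zero |>.1 (le_antisymm this (sq_nonneg y))
      simp [this]
    · exact mul_div_cancel₀ _ (sqrt_pos.2 h0).ne'
  have hl := solidLegendre_eq (sq_sqrt hx) (y / √(1 - x ^ 2)) k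
  rw [hy] at hl
  rw [Q2, diskBasis, hl, rpow_div_two_eq_sqrt _ hx, rpow_natCast]
  ring

/-- The integral over the unit disk in the coordinates `(cos φ, sin φ cos ψ)`. -/
noncomputable def diskIntegral (F : ℝ × ℝ → ℝ) : ℝ :=
  ∫ φ in (0 : ℝ)..π, (∫ ψ in (0 : ℝ)..π, F (cos φ, sin φ * cos ψ) * sin ψ) * sin φ ^ 2

lemma diskIntegral_separated (p g : ℝ → ℝ) (N : ℕ) {F : ℝ × ℝ → ℝ}
    (hF : ∀ x s t, s ^ 2 = 1 - x ^ 2 → F (x, s * t) = p x * (s ^ N * g t)) :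
    diskIntegral F = sinWeightIntegral (N + 2) p * sinWeightIntegral 1 g := by
  unfold diskIntegral sinWeightIntegral
  rw [← intervalIntegral.integral_mul_const]
  refine intervalIntegral.integral_congr fun φ _ => ?_
  have h : ∀ ψ, F (cos φ, sin φ * cos ψ) * sin ψ =
      (p (cos φ) * sin φ ^ N) * (g (cos ψ) * sin ψ ^ 1) := fun ψ => by
    rw [hF _ _ _ (sin_sq φ)]
    ring
  simp only [h]
  rw [intervalIntegral.integral_const_mul]
  ring

lemma diskIntegral_diskBasis_mul (m k m' k' : ℕ) :
    diskIntegral (fun p => diskBasis m k p * diskBasis m' k' p) =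
      if m = m' ∧ k = k' then hConst k (m + k) ^ 2 else 0 := by
  rw [diskIntegral_separated (fun x => gegenbauer (k + 1) m x * gegenbauer (k' + 1) m' x)
    (fun t => gegenbauer (1 / 2) k t * gegenbauer (1 / 2) k' t) (k + k')]
  · by_cases hk : k = k'
    · subst hk
      by_cases hm : m = m'
      · subst hm
        simpa [two_mul] using gegenbauer_sq_mul_legendre_sq k m
      · have h := sinWeightIntegral_gegenbauer_mul_of_ne (ν := 2 * k + 2) (by omega) hm
        rw [show ((2 * k + 2 : ℕ) : ℝ) / 2 = k + 1 by push_cast; ring] at h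
        rw [← two_mul, h]
        simp [hm]
    · have h := sinWeightIntegral_gegenbauer_mul_of_ne one_pos hk
      rw [Nat.cast_one] at h
      rw [h]
      simp [hk]
  · intro x s t hs
    simp only [diskBasis, solidLegendre_eq hs]
    ring

/-- `F` is a polynomial function of total degree at most `d`. -/
def IsPolyOfDegreeLE (d : ℕ) (F : ℝ × ℝ → ℝ) : Prop :=
  ∃ P : MvPolynomial (Fin 2) ℝ, P.totalDegree ≤ d ∧ ∀ p, F p = MvPolynomial.eval ![p.1, p.2] P

namespace IsPolyOfDegreeLE

variable {d e : ℕ} {F G : ℝ × ℝ → ℝ}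

lemma mono (hF : IsPolyOfDegreeLE d F) (h : d ≤ e) : IsPolyOfDegreeLE e F :=
  let ⟨P, hP, hF⟩ := hF
  ⟨P, hP.trans h, hF⟩

lemma mul (hF : IsPolyOfDegreeLE d F) (hG : IsPolyOfDegreeLE e G) :
    IsPolyOfDegreeLE (d + e) (fun p => F p * G p) :=
  let ⟨P, hP, hF⟩ := hF
  let ⟨R, hR, hG⟩ := hG
  ⟨P * R, (MvPolynomial.totalDegree_mul _ _).trans (add_le_add hP hR), by simp [hF, hG]⟩

lemma sub (hF : IsPolyOfDegreeLE d F) (hG : IsPolyOfDegreeLE d G) :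
    IsPolyOfDegreeLE d (fun p => F p - G p) :=
  let ⟨P, hP, hF⟩ := hF
  let ⟨R, hR, hG⟩ := hG
  ⟨P - R, (MvPolynomial.totalDegree_sub _ _).trans (max_le hP hR), by simp [hF, hG]⟩

lemma const (c : ℝ) : IsPolyOfDegreeLE 0 (fun _ => c) :=
  ⟨MvPolynomial.C c, by simp, by simp⟩

lemma fst : IsPolyOfDegreeLE 1 Prod.fst := ⟨MvPolynomial.X 0, by simp, by simp⟩

lemma snd : IsPolyOfDegreeLE 1 Prod.snd := ⟨MvPolynomial.X 1, by simp, by simp⟩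

lemma gegenbauer_fst (lam : ℝ) (n : ℕ) : IsPolyOfDegreeLE n (fun p => gegenbauer lam n p.1) := by
  induction n using Nat.twoStepInduction with
  | zero => exact const 1
  | one => simpa only [gegenbauer, zero_add] using (const (2 * lam)).mul fst
  | more n h₀ h₁ =>
    simp only [gegenbauer]
    exact ((((const _).mul fst).mul h₁).mono (by omega)).sub (((const _).mul h₀).mono (by omega))

lemma solidLegendre (k : ℕ) : IsPolyOfDegreeLE k (solidLegendre k) := by
  induction k using Nat.twoStepInduction with
  | zero => simpa only [funext fun p => solidLegendre.eq_1 p] using const 1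
  | one => simpa only [funext fun p => solidLegendre.eq_2 p] using snd
  | more k h₀ h₁ =>
    rw [funext fun p => solidLegendre.eq_3 p k]
    have h : IsPolyOfDegreeLE 2 (fun p => 1 - p.1 ^ 2) := by
      simpa only [pow_two] using ((const 1).mono (by omega)).sub (fst.mul fst)
    exact ((((const _).mul snd).mul h₁).mono (by omega)).sub
      ((((const _).mul h).mul h₀).mono (by omega))

lemma diskBasis (m k : ℕ) : IsPolyOfDegreeLE (m + k) (diskBasis m k) :=
  (gegenbauer_fst _ m).mul (solidLegendre k)

end IsPolyOfDegreeLE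

/-- The rectangle rule with `N` nodes integrates `h` exactly over a full period. -/
def RectangleRuleExact (N : ℕ) (h : ℝ → ℂ) : Prop :=
  ∑ m ∈ Finset.range N, h (2 * π * m / N) * (2 * π / N) = ∫ θ in (0 : ℝ)..(2 * π), h θ

lemma RectangleRuleExact.linear {N : ℕ} {g h : ℝ → ℂ} (hg : RectangleRuleExact N g)
    (hh : RectangleRuleExact N h) (hgc : Continuous g) (hhc : Continuous h) (a b : ℂ) :
    RectangleRuleExact N (fun θ => a * g θ + b * h θ) := by
  unfold RectangleRuleExact at *
  rw [intervalIntegral.integral_add, intervalIntegral.integral_const_mul,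
    intervalIntegral.integral_const_mul, ← hg, ← hh, Finset.mul_sum, Finset.mul_sum,
    ← Finset.sum_add_distrib]
  · exact Finset.sum_congr rfl fun m _ => by ring
  all_goals exact Continuous.intervalIntegrable (by fun_prop) _ _

lemma rectangleRuleExact_exp {N : ℕ} {k : ℤ} (hk : k.natAbs < N) :
    RectangleRuleExact N (fun θ => Complex.exp (k * Complex.I * θ)) := by
  have hN : (N : ℂ) ≠ 0 := by exact_mod_cast (by omega : N ≠ 0)
  have hπ : (π : ℂ) ≠ 0 := by exact_mod_cast pi_ne_zero
  unfold RectangleRuleExact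
  rcases eq_or_ne k 0 with rfl | hk₀
  · simp
    field_simp
  · have hk₁ : (k : ℂ) ≠ 0 := by exact_mod_cast hk₀
    have hc : (k : ℂ) * Complex.I ≠ 0 := mul_ne_zero hk₁ Complex.I_ne_zero
    rw [integral_exp_mul_complex hc, ← Finset.sum_mul]
    have hper : Complex.exp (k * Complex.I * (2 * π : ℝ)) = 1 := by
      rw [Complex.exp_eq_one_iff]
      exact ⟨k, by push_cast; ring⟩
    have hζ : Complex.exp (k * Complex.I * (2 * π / N)) ≠ 1 := by
      rw [Ne, Complex.exp_eq_one_iff]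
      rintro ⟨n, hn⟩
      have : (k : ℂ) = n * N := by
        field_simp at hn
        rw [hn, mul_comm]
      have h' : k = n * N := by exact_mod_cast this
      have : (N : ℤ) ∣ k := ⟨n, by rw [h', mul_comm]⟩
      have := Nat.le_of_dvd (Int.natAbs_pos.2 hk₀) (Int.natCast_dvd.1 this)
      omega
    have hsum : ∑ m ∈ Finset.range N, Complex.exp (k * Complex.I * (2 * π * m / N : ℝ)) = 0 := by
      have h : ∀ m : ℕ, Complex.exp (k * Complex.I * (2 * π * m / N : ℝ)) =
          Complex.exp (k * Complex.I * (2 * π / N)) ^ m := fun m => by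
        rw [← Complex.exp_nat_mul]
        congr 1
        push_cast
        ring
      simp only [h]
      rw [geom_sum_eq hζ, ← Complex.exp_nat_mul,
        show (N : ℂ) * (k * Complex.I * (2 * π / N)) = k * Complex.I * (2 * π : ℝ) by
          push_cast; field_simp, hper]
      simp
    rw [hsum, hper]
    simp

lemma rectangleRuleExact_exp_mul_cos_mul_sin (N a b : ℕ) :
    ∀ k : ℤ, k.natAbs + a + b < N → RectangleRuleExact N
      (fun θ => Complex.exp (k * Complex.I * θ) * (cos θ : ℂ) ^ a * (sin θ : ℂ) ^ b) := by
  induction b with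
  | zero =>
    induction a with
    | zero =>
      intro k hk
      simpa only [pow_zero, mul_one] using rectangleRuleExact_exp (by omega)
    | succ a ih =>
      intro k hk
      convert (ih (k + 1) (by omega)).linear (ih (k - 1) (by omega)) (by fun_prop) (by fun_prop)
        (1 / 2) (1 / 2) using 2 with θ
      have e₁ : ((k + 1 : ℤ) : ℂ) * Complex.I * θ = k * Complex.I * θ + θ * Complex.I := by
        push_cast; ring
      have e₂ : ((k - 1 : ℤ) : ℂ) * Complex.I * θ = k * Complex.I * θ + -θ * Complex.I := by
        push_cast; ring
      have hc := Complex.two_cos (θ : ℂ)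
      rw [e₁, e₂, Complex.exp_add, Complex.exp_add, Complex.ofReal_cos]
      linear_combination
        (1 / 2) * Complex.exp (k * Complex.I * θ) * Complex.cos (θ : ℂ) ^ a * hc
  | succ b ih =>
    intro k hk
    convert (ih (k + 1) (by omega)).linear (ih (k - 1) (by omega)) (by fun_prop) (by fun_prop)
      (-Complex.I / 2) (Complex.I / 2) using 2 with θ
    have e₁ : ((k + 1 : ℤ) : ℂ) * Complex.I * θ = k * Complex.I * θ + θ * Complex.I := by
      push_cast; ring
    have e₂ : ((k - 1 : ℤ) : ℂ) * Complex.I * θ = k * Complex.I * θ + -θ * Complex.I := by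
      push_cast; ring
    have hs := Complex.two_sin (θ : ℂ)
    rw [e₁, e₂, Complex.exp_add, Complex.exp_add, Complex.ofReal_cos, Complex.ofReal_sin]
    linear_combination (1 / 2) * Complex.exp (k * Complex.I * θ) * Complex.cos (θ : ℂ) ^ a *
      Complex.sin (θ : ℂ) ^ b * hs

lemma sum_cos_pow_mul_sin_pow {N a b : ℕ} (h : a + b < N) :
    ∑ m ∈ Finset.range N,
        cos (2 * π * m / N) ^ a * sin (2 * π * m / N) ^ b * (2 * π / N) =
      ∫ θ in (0 : ℝ)..(2 * π), cos θ ^ a * sin θ ^ b := by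
  have h' := rectangleRuleExact_exp_mul_cos_mul_sin N a b 0 (by simpa using h)
  simp only [RectangleRuleExact, Int.cast_zero, zero_mul, Complex.exp_zero, one_mul] at h'
  have e : ∀ θ : ℝ, (cos θ : ℂ) ^ a * (sin θ : ℂ) ^ b = ((cos θ ^ a * sin θ ^ b : ℝ) : ℂ) :=
    fun θ => by push_cast; rfl
  simp only [e] at h'
  rw [intervalIntegral.integral_ofReal] at h'
  exact_mod_cast h'

lemma integral_cos_pow_mul_sin_pow_period (a b : ℕ) :
    ∫ θ in (0 : ℝ)..(2 * π), cos θ ^ a * sin θ ^ b =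
      (1 + (-1) ^ b) * sinWeightIntegral b (fun t => t ^ a) := by
  have h := intervalIntegral.integral_comp_sub_left
    (fun θ => cos θ ^ a * sin θ ^ b) (a := 0) (b := π) (2 * π)
  rw [← intervalIntegral.integral_add_adjacent_intervals (b := π)
    (Continuous.intervalIntegrable (by fun_prop) _ _)
    (Continuous.intervalIntegrable (by fun_prop) _ _)]
  rw [sub_zero, show 2 * π - π = π by ring] at h
  rw [← h]
  simp only [cos_two_pi_sub, sin_two_pi_sub]
  rw [add_mul, one_mul, sinWeightIntegral, ← intervalIntegral.integral_const_mul]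
  congr 1
  refine intervalIntegral.integral_congr fun θ _ => ?_
  rw [neg_pow]
  ring

lemma integral_cos_pow_mul_sin (b : ℕ) :
    sinWeightIntegral 1 (fun t => t ^ b) = (1 + (-1) ^ b) / (b + 1) := by
  have : ∫ φ in (0 : ℝ)..π, cos φ ^ b * sin φ ^ 1 =
      -(cos π ^ (b + 1) / (b + 1)) - -(cos 0 ^ (b + 1) / (b + 1)) := by
    refine intervalIntegral.integral_eq_sub_of_hasDerivAt
      (f := fun φ => -(cos φ ^ (b + 1) / (b + 1))) (fun φ _ => ?_)
      (Continuous.intervalIntegrable (by fun_prop) _ _)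
    refine ((((hasDerivAt_cos φ).pow (b + 1)).div_const _).neg).congr_deriv ?_
    have hb : (b : ℝ) + 1 ≠ 0 := by positivity
    simp only [Nat.add_sub_cancel]
    push_cast
    field_simp
  rw [sinWeightIntegral, this, cos_pi, cos_zero]
  ring

/-- The discrete integral underlying the hyperinterpolation inner product. -/
noncomputable def diskQuadrature (q : ℕ) (r ω : ℕ → ℝ) (F : ℝ × ℝ → ℝ) : ℝ :=
  ∑ l ∈ Finset.range (q + 1), ∑ m ∈ Finset.range (2 * q + 1),
    F (r l * cos (2 * π * m / (2 * q + 1)), r l * sin (2 * π * m / (2 * q + 1))) *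
      ω l * (2 * π / (2 * q + 1)) * r l

lemma diskQuadrature_add (q : ℕ) (r ω : ℕ → ℝ) (F G : ℝ × ℝ → ℝ) :
    diskQuadrature q r ω (fun p => F p + G p) =
      diskQuadrature q r ω F + diskQuadrature q r ω G := by
  simp only [diskQuadrature, ← Finset.sum_add_distrib, add_mul]

lemma diskQuadrature_const_mul (q : ℕ) (r ω : ℕ → ℝ) (c : ℝ) (F : ℝ × ℝ → ℝ) :
    diskQuadrature q r ω (fun p => c * F p) = c * diskQuadrature q r ω F := by
  simp only [diskQuadrature, Finset.mul_sum, mul_assoc]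

lemma diskIntegral_add {F G : ℝ × ℝ → ℝ} (hF : Continuous F) (hG : Continuous G) :
    diskIntegral (fun p => F p + G p) = diskIntegral F + diskIntegral G := by
  have h : ∀ {F : ℝ × ℝ → ℝ}, Continuous F → Continuous fun φ : ℝ =>
      ∫ ψ in (0 : ℝ)..π, F (cos φ, sin φ * cos ψ) * sin ψ := fun hF =>
    intervalIntegral.continuous_parametric_intervalIntegral_of_continuous' (by fun_prop) _ _
  have hF' := h hF
  have hG' := h hG
  unfold diskIntegral
  rw [← intervalIntegral.integral_add]
  · refine intervalIntegral.integral_congr fun φ _ => ?_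
    simp only
    rw [← add_mul, ← intervalIntegral.integral_add]
    · simp only [add_mul]
    all_goals exact Continuous.intervalIntegrable (by fun_prop) _ _
  all_goals exact Continuous.intervalIntegrable (by fun_prop) _ _

lemma diskIntegral_const_mul (c : ℝ) (F : ℝ × ℝ → ℝ) :
    diskIntegral (fun p => c * F p) = c * diskIntegral F := by
  simp only [diskIntegral, mul_assoc, intervalIntegral.integral_const_mul]

section Quadrature

variable {q : ℕ} {r ω : ℕ → ℝ}

lemma diskQuadrature_monomial
    (hquad : ∀ p : Polynomial ℝ, p.natDegree ≤ 2 * q + 1 →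
      (∫ t in (0 : ℝ)..1, p.eval t) = ∑ l ∈ Finset.range (q + 1), ω l * p.eval (r l))
    {a b : ℕ} (hab : a + b ≤ 2 * q) :
    diskQuadrature q r ω (fun p => p.1 ^ a * p.2 ^ b) =
      diskIntegral (fun p => p.1 ^ a * p.2 ^ b) := by
  have hrad := hquad (Polynomial.X ^ (a + b + 1)) (by rw [Polynomial.natDegree_X_pow]; omega)
  simp only [Polynomial.eval_pow, Polynomial.eval_X, integral_pow] at hrad
  have hang := sum_cos_pow_mul_sin_pow (N := 2 * q + 1) (a := a) (b := b) (by omega)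
  rw [integral_cos_pow_mul_sin_pow_period] at hang
  have hQ : diskQuadrature q r ω (fun p => p.1 ^ a * p.2 ^ b) =
      (∑ l ∈ Finset.range (q + 1), ω l * r l ^ (a + b + 1)) *
        ((1 + (-1) ^ b) * sinWeightIntegral b (fun t => t ^ a)) := by
    rw [← hang, Finset.sum_mul_sum]
    refine Finset.sum_congr rfl fun l _ => Finset.sum_congr rfl fun m _ => ?_
    push_cast
    ring
  rw [hQ, ← hrad, diskIntegral_separated (fun t => t ^ a) (fun t => t ^ b) b
    (fun x s t _ => by simp only; ring), integral_cos_pow_mul_sin]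
  have hJ := sinWeightIntegral_pow_add_two a b
  have h₁ : (b : ℝ) + 1 ≠ 0 := by positivity
  have h₂ : (a : ℝ) + b + 1 + 1 ≠ 0 := by positivity
  push_cast
  field_simp
  rw [one_pow, zero_pow (by omega)]
  linear_combination (-(1 + (-1) ^ b)) * hJ

lemma diskQuadrature_eq_diskIntegral
    (hquad : ∀ p : Polynomial ℝ, p.natDegree ≤ 2 * q + 1 →
      (∫ t in (0 : ℝ)..1, p.eval t) = ∑ l ∈ Finset.range (q + 1), ω l * p.eval (r l))
    {F : ℝ × ℝ → ℝ} (hF : IsPolyOfDegreeLE (2 * q) F) :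
    diskQuadrature q r ω F = diskIntegral F := by
  obtain ⟨P, hP, hF⟩ := hF
  have hF' : F = fun p => ∑ s ∈ P.support, P.coeff s * (p.1 ^ s 0 * p.2 ^ s 1) := by
    ext p
    simp [hF, MvPolynomial.eval_eq', Fin.prod_univ_two]
  have key : ∀ S ⊆ P.support,
      diskQuadrature q r ω (fun p => ∑ s ∈ S, P.coeff s * (p.1 ^ s 0 * p.2 ^ s 1)) =
        diskIntegral (fun p => ∑ s ∈ S, P.coeff s * (p.1 ^ s 0 * p.2 ^ s 1)) := by
    intro S
    induction S using Finset.induction_on with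
    | empty => simp [diskQuadrature, diskIntegral]
    | insert s S hs ih =>
      intro hS
      simp only [Finset.sum_insert hs]
      have hdeg : s 0 + s 1 ≤ 2 * q := by
        have := MvPolynomial.le_totalDegree (hS (Finset.mem_insert_self s S))
        rw [Finsupp.sum_fintype _ _ (fun _ => rfl), Fin.sum_univ_two] at this
        omega
      rw [diskQuadrature_add, diskIntegral_add (by fun_prop) (by fun_prop),
        diskQuadrature_const_mul, diskIntegral_const_mul, diskQuadrature_monomial hquad hdeg,
        ih ((Finset.subset_insert s S).trans hS)]
  rw [hF', key _ subset_rfl]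

end Quadrature

/-- The span of the basis polynomials `diskBasis m k` of degree `m + k ≤ n`. -/
def diskSpan (n : ℕ) : Submodule ℝ (ℝ × ℝ → ℝ) :=
  Submodule.span ℝ {F | ∃ m k, m + k ≤ n ∧ F = diskBasis m k}

lemma diskBasis_mem_diskSpan {n m k : ℕ} (h : m + k ≤ n) : diskBasis m k ∈ diskSpan n :=
  Submodule.subset_span ⟨m, k, h, rfl⟩

lemma fst_mul_mem_diskSpan {n : ℕ} {F : ℝ × ℝ → ℝ} (hF : F ∈ diskSpan n) :
    Prod.fst * F ∈ diskSpan (n + 1) := by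
  induction hF using Submodule.span_induction with
  | zero => simp
  | add F G _ _ hF hG => rw [mul_add]; exact add_mem hF hG
  | smul c F _ hF => rw [mul_smul_comm]; exact Submodule.smul_mem _ c hF
  | mem F h =>
    obtain ⟨m, k, h, rfl⟩ := h
    rcases m with _ | m
    · have e : Prod.fst * diskBasis 0 k = (1 / (2 * ((k : ℝ) + 1))) • diskBasis 1 k := by
        ext p
        have hk : (k : ℝ) + 1 ≠ 0 := by positivity
        simp only [Pi.mul_apply, Pi.smul_apply, smul_eq_mul, diskBasis, gegenbauer]
        field_simp
      rw [e]
      exact Submodule.smul_mem _ _ (diskBasis_mem_diskSpan (by omega))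
    · have e : Prod.fst * diskBasis (m + 1) k =
          (((m : ℝ) + 2) / (2 * (m + 1 + (k + 1)))) • diskBasis (m + 2) k +
            (((m : ℝ) + 2 * (k + 1)) / (2 * (m + 1 + (k + 1)))) • diskBasis m k := by
        ext p
        have hk : (m : ℝ) + 1 + (k + 1) ≠ 0 := by positivity
        have hr := gegenbauer_succ_succ (k + 1) m p.1
        simp only [Pi.mul_apply, Pi.add_apply, Pi.smul_apply, smul_eq_mul, diskBasis]
        field_simp
        linear_combination (-solidLegendre k p) * hr
      rw [e]
      exact add_mem (Submodule.smul_mem _ _ (diskBasis_mem_diskSpan (by omega)))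
        (Submodule.smul_mem _ _ (diskBasis_mem_diskSpan (by omega)))

/-- The span of the functions `x^i H_k` of degree `i + k ≤ n`, with `H_k` the solid Legendre
polynomials. -/
def solidSpan (n : ℕ) : Submodule ℝ (ℝ × ℝ → ℝ) :=
  Submodule.span ℝ {F | ∃ i k, i + k ≤ n ∧ F = Prod.fst ^ i * solidLegendre k}

lemma fst_pow_mul_solidLegendre_mem_solidSpan {n i k : ℕ} (h : i + k ≤ n) :
    Prod.fst ^ i * solidLegendre k ∈ solidSpan n :=
  Submodule.subset_span ⟨i, k, h, rfl⟩

lemma solidSpan_le_diskSpan (n : ℕ) : solidSpan n ≤ diskSpan n := by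
  have key : ∀ i k, Prod.fst ^ i * solidLegendre k ∈ diskSpan (k + i) := by
    intro i k
    induction i with
    | zero =>
      convert diskBasis_mem_diskSpan (n := k + 0) (m := 0) (k := k) (by omega) using 1
      ext p
      simp [diskBasis, gegenbauer]
    | succ i ih =>
      rw [pow_succ', mul_assoc]
      exact fst_mul_mem_diskSpan ih
  refine Submodule.span_le.2 ?_
  rintro F ⟨i, k, h, rfl⟩
  refine Submodule.span_mono ?_ (key i k)
  rintro G ⟨m, k', h', rfl⟩
  exact ⟨m, k', by omega, rfl⟩

lemma fst_mul_mem_solidSpan {n : ℕ} {F : ℝ × ℝ → ℝ} (hF : F ∈ solidSpan n) :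
    Prod.fst * F ∈ solidSpan (n + 1) := by
  induction hF using Submodule.span_induction with
  | zero => simp
  | add F G _ _ hF hG => rw [mul_add]; exact add_mem hF hG
  | smul c F _ hF => rw [mul_smul_comm]; exact Submodule.smul_mem _ c hF
  | mem F h =>
    obtain ⟨i, k, h, rfl⟩ := h
    rw [← mul_assoc, ← pow_succ']
    exact fst_pow_mul_solidLegendre_mem_solidSpan (by omega)

lemma snd_mul_mem_solidSpan {n : ℕ} {F : ℝ × ℝ → ℝ} (hF : F ∈ solidSpan n) :
    Prod.snd * F ∈ solidSpan (n + 1) := by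
  induction hF using Submodule.span_induction with
  | zero => simp
  | add F G _ _ hF hG => rw [mul_add]; exact add_mem hF hG
  | smul c F _ hF => rw [mul_smul_comm]; exact Submodule.smul_mem _ c hF
  | mem F h =>
    obtain ⟨i, k, h, rfl⟩ := h
    rcases k with _ | k
    · convert fst_pow_mul_solidLegendre_mem_solidSpan (n := n + 1) (i := i) (k := 1) (by omega)
        using 1
      ext p
      simp [solidLegendre, mul_comm]
    · have e : Prod.snd * (Prod.fst ^ i * solidLegendre (k + 1)) =
          (((k : ℝ) + 2) / (2 * k + 3)) • (Prod.fst ^ i * solidLegendre (k + 2)) +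
            (((k : ℝ) + 1) / (2 * k + 3)) • (Prod.fst ^ i * solidLegendre k) -
            (((k : ℝ) + 1) / (2 * k + 3)) • (Prod.fst ^ (i + 2) * solidLegendre k) := by
        ext p
        have h₁ : 2 * (k : ℝ) + 3 ≠ 0 := by positivity
        have h₂ : (k : ℝ) + 2 ≠ 0 := by positivity
        simp only [Pi.mul_apply, Pi.add_apply, Pi.sub_apply, Pi.smul_apply, Pi.pow_apply,
          smul_eq_mul, solidLegendre]
        field_simp
        ring
      rw [e]
      exact sub_mem (add_mem
        (Submodule.smul_mem _ _ (fst_pow_mul_solidLegendre_mem_solidSpan (by omega)))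
        (Submodule.smul_mem _ _ (fst_pow_mul_solidLegendre_mem_solidSpan (by omega))))
        (Submodule.smul_mem _ _ (fst_pow_mul_solidLegendre_mem_solidSpan (by omega)))

lemma monomial_mem_diskSpan {n a b : ℕ} (h : a + b ≤ n) :
    (fun p : ℝ × ℝ => p.1 ^ a * p.2 ^ b) ∈ diskSpan n := by
  have key : (Prod.fst ^ a * Prod.snd ^ b : ℝ × ℝ → ℝ) ∈ solidSpan (b + a) := by
    induction a with
    | zero =>
      induction b with
      | zero =>
        convert fst_pow_mul_solidLegendre_mem_solidSpan (n := 0) (i := 0) (k := 0) le_rfl using 1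
        ext p
        simp [solidLegendre]
      | succ b ih =>
        rw [pow_succ', mul_left_comm, add_right_comm]
        exact snd_mul_mem_solidSpan (ih (by omega))
    | succ a ih =>
      rw [pow_succ', mul_assoc]
      exact fst_mul_mem_solidSpan (ih (by omega))
  refine Submodule.span_mono ?_ (solidSpan_le_diskSpan _ key)
  rintro G ⟨m, k, h', rfl⟩
  exact ⟨m, k, by omega, rfl⟩

lemma eval_mem_diskSpan {n : ℕ} {f : MvPolynomial (Fin 2) ℝ} (hf : f.totalDegree ≤ n) :
    (fun p : ℝ × ℝ => MvPolynomial.eval ![p.1, p.2] f) ∈ diskSpan n := by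
  have e : (fun p : ℝ × ℝ => MvPolynomial.eval ![p.1, p.2] f) =
      ∑ s ∈ f.support, f.coeff s • fun p : ℝ × ℝ => p.1 ^ s 0 * p.2 ^ s 1 := by
    ext p
    simp [MvPolynomial.eval_eq', Fin.prod_univ_two]
  rw [e]
  refine Submodule.sum_mem _ fun s hs => Submodule.smul_mem _ _ (monomial_mem_diskSpan ?_)
  have := MvPolynomial.le_totalDegree hs
  rw [Finsupp.sum_fintype _ _ (fun _ => rfl), Fin.sum_univ_two] at this
  omega

/-- The orthonormal expansion with discrete coefficients reproduces the span of the basis. -/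
lemma diskQuadrature_reproduces {n q : ℕ} (hq : n ≤ q) {r ω : ℕ → ℝ}
    (hquad : ∀ p : Polynomial ℝ, p.natDegree ≤ 2 * q + 1 →
      (∫ t in (0 : ℝ)..1, p.eval t) = ∑ l ∈ Finset.range (q + 1), ω l * p.eval (r l))
    {F : ℝ × ℝ → ℝ} (hF : F ∈ diskSpan n) (z : ℝ × ℝ) :
    ∑ j ∈ Finset.range (n + 1), ∑ k ∈ Finset.range (j + 1),
      diskQuadrature q r ω (fun p => F p * (1 / hConst k j * diskBasis (j - k) k p)) *
        (1 / hConst k j * diskBasis (j - k) k z) = F z := by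
  induction hF using Submodule.span_induction with
  | zero => simp [diskQuadrature]
  | add F G _ _ hF hG =>
    simp only [Pi.add_apply, add_mul, diskQuadrature_add, Finset.sum_add_distrib]
    rw [hF, hG]
  | smul c F _ hF =>
    simp only [Pi.smul_apply, smul_eq_mul, mul_assoc, diskQuadrature_const_mul, ← Finset.mul_sum]
    rw [← hF]
  | mem F h =>
    obtain ⟨m, k, h, rfl⟩ := h
    have hh : hConst k (m + k) ≠ 0 := by
      unfold hConst
      positivity
    have hcoef : ∀ j ≤ n, ∀ k' ≤ j,
        diskQuadrature q r ω (fun p => diskBasis m k p *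
          (1 / hConst k' j * diskBasis (j - k') k' p)) =
        if m = j - k' ∧ k = k' then hConst k (m + k) else 0 := by
      intro j hj k' hk'
      simp only [mul_left_comm _ (1 / hConst k' j)]
      rw [diskQuadrature_const_mul, diskQuadrature_eq_diskIntegral hquad
        (((IsPolyOfDegreeLE.diskBasis m k).mul
          (IsPolyOfDegreeLE.diskBasis (j - k') k')).mono (by omega)), diskIntegral_diskBasis_mul]
      split_ifs with hjk
      · obtain ⟨h₁, rfl⟩ := hjk
        rw [show j = m + k by omega]
        field_simp
      · rw [mul_zero]
    rw [Finset.sum_eq_single (m + k), Finset.sum_eq_single k]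
    · rw [hcoef _ h _ (by omega), if_pos ⟨by omega, rfl⟩, Nat.add_sub_cancel]
      field_simp
    · intro k' hk' hne
      rw [hcoef _ h _ (by simpa [Nat.lt_succ_iff] using hk'), if_neg (fun e => hne e.2.symm),
        zero_mul]
    · exact fun hk => absurd (Finset.mem_range.2 (by omega)) hk
    · intro j hj hne
      refine Finset.sum_eq_zero fun k' hk' => ?_
      simp only [Finset.mem_range, Nat.lt_succ_iff] at hj hk'
      rw [hcoef _ hj _ hk', if_neg (fun e => hne (by omega)), zero_mul]
    · exact fun hk => absurd (Finset.mem_range.2 (by omega)) hk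

/-- the discrete least squares (hyperinterpolation) operator with
`q ≥ n` reproduces all polynomials of total degree at most `n` on the disk. -/
theorem hyperinterpolation_reproduces (n q : ℕ) (hq : n ≤ q) (r ω : ℕ → ℝ)
    (hr : ∀ l ≤ q, r l ∈ Set.Icc (0 : ℝ) 1)
    (hquad : ∀ p : Polynomial ℝ, p.natDegree ≤ 2 * q + 1 →
      (∫ t in (0 : ℝ)..1, p.eval t) =
        ∑ l ∈ Finset.range (q + 1), ω l * p.eval (r l))
    (f : MvPolynomial (Fin 2) ℝ) (hf : f.totalDegree ≤ n)
    (x y : ℝ) (hxy : (x, y) ∈ unitDisk) :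
    MvPolynomial.eval ![x, y] f =
      ∑ j ∈ Finset.range (n + 1), ∑ k ∈ Finset.range (j + 1),
        (∑ l ∈ Finset.range (q + 1), ∑ m ∈ Finset.range (2 * q + 1),
          MvPolynomial.eval
              ![r l * Real.cos (2 * π * m / (2 * q + 1)),
                r l * Real.sin (2 * π * m / (2 * q + 1))] f *
            Q2 j k (r l * Real.cos (2 * π * m / (2 * q + 1)))
              (r l * Real.sin (2 * π * m / (2 * q + 1))) *
            ω l * (2 * π / (2 * q + 1)) * r l) *
          Q2 j k x y := by
  have h := diskQuadrature_reproduces hq hquad (eval_mem_diskSpan hf) (x, y)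
  rw [← h]
  refine Finset.sum_congr rfl fun j _ => Finset.sum_congr rfl fun k _ => ?_
  rw [Q2_eq (le_of_lt hxy)]
  congr 1
  refine Finset.sum_congr rfl fun l hl => Finset.sum_congr rfl fun m _ => ?_
  rw [Q2_eq]
  obtain ⟨h₀, h₁⟩ := hr l (by simpa [Nat.lt_succ_iff] using hl)
  rw [mul_pow, mul_pow, ← mul_add, cos_sq_add_sin_sq, mul_one]
  exact pow_le_one₀ h₀ h₁
end
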